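/- (Bonin–Shapiro–Simion) For every positive integer n and every integer k with 0 ≤ k ≤ n, the polynomial identity [n−k+1]_q · Σ_{w} q^{maj(w)} = [2n−k choose k]_q · [2n−2k choose n−k]_q holds in ℤ[q], where the sum is over all Schröder words w of length 2n−k with exactly k letters equal to 1, n−k letters equal to 0 and n−k letters equal to 2, such that every prefix of w contains at least as many 0's as 2's. -/

import Mathlib

open Polynomial

/-- The q-integer `[n]_q = 1 + q + ⋯ + q^(n-1)` in `ℤ[q]`. -/
noncomputable def qInt (n : ℕ) : Polynomial ℤ := ∑ i ∈ Finset.range n, X ^ i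

/-- The Gaussian binomial coefficient `[a choose b]_q` in `ℤ[q]`, defined by the
standard q-Pascal recurrence `[n+1 choose k+1] = [n choose k] + q^(k+1) [n choose k+1]`. -/
noncomputable def qBinom : ℕ → ℕ → Polynomial ℤ
  | _, 0 => 1
  | 0, _ + 1 => 0
  | n + 1, k + 1 => qBinom n k + X ^ (k + 1) * qBinom n (k + 1)

/-- Schröder words of length 2n−k over {0,1,2} (encoded as `Fin 3`), with k letters 1,
n−k letters 0, n−k letters 2, and every prefix having at least as many 0's as 2's. -/
def SchroederWords (n k : ℕ) : Set (Fin (2 * n - k) → Fin 3) :=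
  {w | (Finset.univ.filter (fun i : Fin (2 * n - k) => w i = 1)).card = k ∧
       (Finset.univ.filter (fun i : Fin (2 * n - k) => w i = 0)).card = n - k ∧
       (Finset.univ.filter (fun i : Fin (2 * n - k) => w i = 2)).card = n - k ∧
       ∀ j : ℕ, (Finset.univ.filter (fun i : Fin (2 * n - k) => (i : ℕ) < j ∧ w i = 2)).card ≤
                (Finset.univ.filter (fun i : Fin (2 * n - k) => (i : ℕ) < j ∧ w i = 0)).card}

/-- Major index of a word w = w_1 ⋯ w_N (0-indexed here): the sum of all positions
p (1 ≤ p ≤ N−1, 1-indexed) with w_p > w_{p+1}. -/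
def wMaj {N : ℕ} (w : Fin N → Fin 3) : ℕ :=
  ∑ i ∈ Finset.range N,
    if h : i + 1 < N then
      (if w ⟨i + 1, h⟩ < w ⟨i, Nat.lt_of_succ_lt h⟩ then i + 1 else 0)
    else 0

lemma qBinom_zero_right (n : ℕ) : qBinom n 0 = 1 := by
  cases n <;> simp [qBinom]

lemma qBinom_succ_succ (n k : ℕ) :
    qBinom (n + 1) (k + 1) = qBinom n k + X ^ (k + 1) * qBinom n (k + 1) := by
  simp [qBinom]

lemma qBinom_eq_zero : ∀ (n k : ℕ), n < k → qBinom n k = 0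
  | 0, 0, h => by omega
  | 0, k + 1, _ => by simp [qBinom]
  | n + 1, 0, h => by omega
  | n + 1, k + 1, h => by
    rw [qBinom_succ_succ, qBinom_eq_zero n k (by omega), qBinom_eq_zero n (k + 1) (by omega)]
    simp

/-- Written with `m = k + d`. -/
lemma qBinom_A : ∀ (m k d : ℕ), m = k + d →
    (1 - X ^ (k + 1)) * qBinom m (k + 1) = (1 - X ^ d) * qBinom m k := by
  intro m
  induction m with
  | zero =>
    intro k d h
    obtain rfl : k = 0 := by omega
    obtain rfl : d = 0 := by omega
    simp [qBinom]
  | succ m ih =>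
    intro k d h
    cases k with
    | zero =>
      have h1 := ih 0 m (by omega)
      obtain rfl : d = m + 1 := by omega
      rw [qBinom_succ_succ, qBinom_zero_right, qBinom_zero_right]
      rw [qBinom_zero_right] at h1
      simp only [zero_add] at *
      linear_combination X ^ 1 * h1
    | succ k =>
      cases d with
      | zero =>
        rw [qBinom_eq_zero (m + 1) (k + 1 + 1) (by omega)]
        simp
      | succ d =>
        have h1 := ih (k + 1) d (by omega)
        have h2 := ih k (d + 1) (by omega)
        rw [qBinom_succ_succ m (k + 1), qBinom_succ_succ m k]
        linear_combination X ^ (k + 2) * h1 + h2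

lemma qBinom_pascal2 (m k d : ℕ) (h : m = k + d) :
    qBinom (m + 1) (k + 1) = qBinom m (k + 1) + X ^ d * qBinom m k := by
  have := qBinom_A m k d h
  rw [qBinom_succ_succ]
  linear_combination -this

lemma qBinom_absorb (n k d : ℕ) (h : n + 1 = k + d) :
    (1 - X ^ d) * qBinom (n + 1) k = (1 - X ^ (n + 1)) * qBinom n k := by
  cases k with
  | zero =>
    obtain rfl : d = n + 1 := by omega
    simp [qBinom_zero_right]
  | succ k =>
    have h0 : n = k + d := by omega
    rw [qBinom_pascal2 n k d h0]
    have := qBinom_A n k d h0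
    subst h0
    linear_combination -X ^ d * this

lemma one_sub_X_pow_ne (k : ℕ) : (1 - X ^ (k + 1) : Polynomial ℤ) ≠ 0 := by
  intro h
  have := congrArg (Polynomial.eval 2) h
  simp at this
  have h2 : (2 : ℤ) ^ (k + 1) ≥ 2 := by
    have : (2 : ℤ) ^ k ≥ 1 := one_le_pow₀ (by norm_num)
    rw [pow_succ]; linarith
  linarith

lemma qBinom_symm_mid (c : ℕ) : qBinom (2 * c + 1) (c + 1) = qBinom (2 * c + 1) c := by
  have := qBinom_A (2 * c + 1) c (c + 1) (by omega)
  exact mul_left_cancel₀ (one_sub_X_pow_ne c) this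

noncomputable def qD (a : ℕ) : ℕ → Polynomial ℤ
  | 0 => 1
  | c + 1 => qBinom (a + c + 1) (c + 1) - X * qBinom (a + c + 1) c

noncomputable def qD' (a : ℕ) : ℕ → Polynomial ℤ
  | 0 => 0
  | c + 1 => qD a c

lemma qE_eq (a c : ℕ) : qD a (c + 1) - qD a c =
    X ^ (c + 1) * (qBinom (a + c) (c + 1) - qBinom (a + c) c) := by
  cases c with
  | zero =>
    simp only [qD, qBinom_zero_right, qBinom_succ_succ, add_zero, zero_add]
    ring
  | succ c =>
    simp only [qD]
    rw [show a + (c + 1) + 1 = (a + c + 1) + 1 by ring, qBinom_succ_succ _ (c + 1),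
      qBinom_succ_succ (a + c + 1) c, show a + (c + 1) = a + c + 1 by ring]
    ring

lemma qD_diag (c : ℕ) : qD (c + 1) (c + 1) = qD (c + 1) c := by
  have := qE_eq (c + 1) c
  rw [show c + 1 + c = 2 * c + 1 by ring, qBinom_symm_mid] at this
  linear_combination this

/-- recurrence for `E` -/
lemma qE_rec (a c : ℕ) (h : c ≤ a) :
    qD (a + 1) c - qD' (a + 1) c =
      (qD a c - qD' a c) + X ^ (a + c) * qD' a c := by
  cases c with
  | zero => simp [qD, qD']
  | succ c =>
    simp only [qD']
    rw [qE_eq, qE_eq]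
    have p1 := qBinom_pascal2 (a + c) c a (by omega)
    rw [show a + 1 + c = a + c + 1 by ring, p1]
    cases c with
    | zero =>
      simp only [qBinom_zero_right, qD]; ring
    | succ c =>
      have p2 := qBinom_pascal2 (a + (c + 1)) c (a + 1) (by omega)
      rw [p2]
      simp only [qD]
      rw [show a + (c + 1) = a + c + 1 by ring]
      ring

lemma one_sub_mul_qInt (n : ℕ) : (1 - X) * qInt n = 1 - X ^ n := by
  unfold qInt
  exact mul_neg_geom_sum X n

lemma qD_final (m : ℕ) : qInt (m + 1) * qD m m = qBinom (2 * m) m := by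
  cases m with
  | zero => simp [qInt, qD, qBinom]
  | succ c =>
    have h := qBinom_A (2 * (c + 1)) c (c + 2) (by omega)
    have h1 := one_sub_mul_qInt (c + 1 + 1)
    apply mul_left_cancel₀ (one_sub_X_pow_ne 0)
    simp only [qD]
    rw [show c + 1 + c + 1 = 2 * (c + 1) by ring]
    linear_combination (qBinom (2 * (c + 1)) (c + 1) - X * qBinom (2 * (c + 1)) c) * h1 + X * h

/-! ### Words -/

def pcnt {N : ℕ} (w : Fin N → Fin 3) (j : ℕ) (x : Fin 3) : ℕ :=
  (Finset.univ.filter (fun i : Fin N => (i : ℕ) < j ∧ w i = x)).card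

def cnt {N : ℕ} (w : Fin N → Fin 3) (x : Fin 3) : ℕ :=
  (Finset.univ.filter (fun i : Fin N => w i = x)).card

def lastL : {N : ℕ} → (Fin N → Fin 3) → Fin 3
  | 0, _ => 0
  | N + 1, w => w (Fin.last N)

lemma pcnt_snoc {N : ℕ} (w : Fin N → Fin 3) (y : Fin 3) (j : ℕ) (x : Fin 3) :
    pcnt (Fin.snoc w y : Fin (N + 1) → Fin 3) j x
      = pcnt w j x + if N < j ∧ y = x then 1 else 0 := by
  simp [pcnt, Finset.card_filter, -Finset.sum_boole, Fin.sum_univ_castSucc]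

lemma cnt_snoc {N : ℕ} (w : Fin N → Fin 3) (y x : Fin 3) :
    cnt (Fin.snoc w y : Fin (N + 1) → Fin 3) x = cnt w x + if y = x then 1 else 0 := by
  simp [cnt, Finset.card_filter, -Finset.sum_boole, Fin.sum_univ_castSucc]

lemma pcnt_of_le {N : ℕ} (w : Fin N → Fin 3) (j : ℕ) (hj : N ≤ j) (x : Fin 3) :
    pcnt w j x = cnt w x := by
  unfold pcnt cnt
  congr 1
  ext i
  have := i.2
  simp
  intro _
  omega

def Pref {N : ℕ} (w : Fin N → Fin 3) : Prop := ∀ j, pcnt w j 2 ≤ pcnt w j 0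

lemma Pref_snoc {N : ℕ} (w : Fin N → Fin 3) (y : Fin 3) :
    Pref (Fin.snoc w y : Fin (N + 1) → Fin 3) ↔
      Pref w ∧ cnt (Fin.snoc w y : Fin (N + 1) → Fin 3) 2 ≤
        cnt (Fin.snoc w y : Fin (N + 1) → Fin 3) 0 := by
  constructor
  · intro h
    constructor
    · intro j
      by_cases hj : j ≤ N
      · have := h j
        rw [pcnt_snoc, pcnt_snoc] at this
        simpa [Nat.not_lt.2 hj] using this
      · have := h N
        rw [pcnt_snoc, pcnt_snoc] at this
        rw [pcnt_of_le w j (by omega), pcnt_of_le w j (by omega)]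
        rw [pcnt_of_le w N le_rfl, pcnt_of_le w N le_rfl] at this
        simpa using this
    · have := h (N + 1)
      rwa [pcnt_of_le _ _ le_rfl, pcnt_of_le _ _ le_rfl] at this
  · rintro ⟨h1, h2⟩ j
    by_cases hj : j ≤ N
    · rw [pcnt_snoc, pcnt_snoc]
      simpa [Nat.not_lt.2 hj] using h1 j
    · rwa [pcnt_of_le _ _ (by omega), pcnt_of_le _ _ (by omega)]

lemma wMaj_snoc {N : ℕ} (w : Fin N → Fin 3) (y : Fin 3) :
    wMaj (Fin.snoc w y : Fin (N + 1) → Fin 3) = wMaj w + if y < lastL w then N else 0 := by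
  cases N with
  | zero => simp [wMaj]
  | succ M =>
    unfold wMaj
    rw [Finset.sum_range_succ, Finset.sum_range_succ, Finset.sum_range_succ _ M]
    simp only [lt_self_iff_false, dite_false, add_zero]
    congr 1
    · apply Finset.sum_congr rfl
      intro i hi
      have hi := Finset.mem_range.1 hi
      rw [dif_pos (by omega), dif_pos (by omega)]
      simp [Fin.snoc, hi, show i < M + 1 by omega]
    · simp [Fin.snoc, lastL, Fin.last]
      rfl

open Classical in
noncomputable def TT (N a b c : ℕ) (x : Fin 3) : Polynomial ℤ :=
  ∑ w : Fin N → Fin 3,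
    if (cnt w 0 = a ∧ cnt w 1 = b ∧ cnt w 2 = c ∧ Pref w) ∧ lastL w = x then X ^ wMaj w else 0

open Classical in
noncomputable def SS (N a b c : ℕ) : Polynomial ℤ :=
  ∑ w : Fin N → Fin 3,
    if (cnt w 0 = a ∧ cnt w 1 = b ∧ cnt w 2 = c ∧ Pref w) then X ^ wMaj w else 0

lemma SS_eq (N a b c : ℕ) : SS N a b c = TT N a b c 0 + TT N a b c 1 + TT N a b c 2 := by
  classical
  unfold SS TT
  rw [← Finset.sum_add_distrib, ← Finset.sum_add_distrib]
  apply Finset.sum_congr rfl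
  intro w _
  generalize lastL w = x
  fin_cases x <;> simp

open Classical in
lemma TT_succ (N a b c : ℕ) (y : Fin 3) : TT (N + 1) a b c y =
    ∑ w : Fin N → Fin 3,
      if ((cnt w 0 + (if y = 0 then 1 else 0) = a ∧ cnt w 1 + (if y = 1 then 1 else 0) = b ∧
        cnt w 2 + (if y = 2 then 1 else 0) = c ∧ Pref w) ∧ c ≤ a) then
        X ^ (wMaj w + if y < lastL w then N else 0) else 0 := by
  unfold TT
  rw [← (Fin.snocEquiv (fun _ : Fin (N + 1) => Fin 3)).sum_comp, Fintype.sum_prod_type,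
    Finset.sum_eq_single y]
  · apply Finset.sum_congr rfl
    intro w _
    simp only [Fin.snocEquiv, Equiv.coe_fn_mk]
    rw [wMaj_snoc]
    congr 1
    rw [Pref_snoc]
    simp only [cnt_snoc, lastL, Fin.snoc_last, and_true, eq_iff_iff]
    constructor
    · rintro ⟨rfl, rfl, rfl, h1, h2⟩
      exact ⟨⟨rfl, rfl, rfl, h1⟩, h2⟩
    · rintro ⟨⟨rfl, rfl, rfl, h1⟩, h2⟩
      exact ⟨rfl, rfl, rfl, h1, h2⟩
  · intro z _ hz
    apply Finset.sum_eq_zero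
    intro w _
    rw [if_neg]
    rintro ⟨_, h⟩
    simp [Fin.snocEquiv, lastL] at h
    exact hz h
  · simp

lemma TT_succ_zero (N a b c : ℕ) (h : c ≤ a + 1) : TT (N + 1) (a + 1) b c 0 =
    TT N a b c 0 + X ^ N * (TT N a b c 1 + TT N a b c 2) := by
  classical
  rw [TT_succ]
  unfold TT
  rw [← Finset.sum_add_distrib, Finset.mul_sum, ← Finset.sum_add_distrib]
  apply Finset.sum_congr rfl
  intro w _
  generalize lastL w = x
  fin_cases x <;> simp [h, pow_add, mul_comm]

lemma TT_succ_one (N a b c : ℕ) (h : c ≤ a) : TT (N + 1) a (b + 1) c 1 =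
    TT N a b c 0 + TT N a b c 1 + X ^ N * TT N a b c 2 := by
  classical
  rw [TT_succ]
  unfold TT
  rw [← Finset.sum_add_distrib, Finset.mul_sum, ← Finset.sum_add_distrib]
  apply Finset.sum_congr rfl
  intro w _
  generalize lastL w = x
  fin_cases x <;> simp [h, pow_add, mul_comm]

lemma TT_succ_two (N a b c : ℕ) (h : c + 1 ≤ a) : TT (N + 1) a b (c + 1) 2 = SS N a b c := by
  classical
  rw [TT_succ]
  unfold SS
  apply Finset.sum_congr rfl
  intro w _
  generalize lastL w = x
  fin_cases x <;> simp [h]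

lemma SS_bad (N a b c : ℕ) (h : a < c) : SS N a b c = 0 := by
  classical
  unfold SS
  apply Finset.sum_eq_zero
  intro w _
  rw [if_neg]
  rintro ⟨rfl, _, rfl, h4⟩
  have := h4 N
  rw [pcnt_of_le _ _ le_rfl, pcnt_of_le _ _ le_rfl] at this
  omega

lemma TT_bad (N a b c : ℕ) (x : Fin 3) (h : a < c) : TT N a b c x = 0 := by
  classical
  unfold TT
  apply Finset.sum_eq_zero
  intro w _
  rw [if_neg]
  rintro ⟨⟨rfl, _, rfl, h4⟩, _⟩
  have := h4 N
  rw [pcnt_of_le _ _ le_rfl, pcnt_of_le _ _ le_rfl] at this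
  omega

lemma TT_zero_of (N b c : ℕ) : TT (N + 1) 0 b c 0 = 0 := by
  classical
  rw [TT_succ]
  exact Finset.sum_eq_zero fun w _ => by simp

lemma TT_one_of (N a c : ℕ) : TT (N + 1) a 0 c 1 = 0 := by
  classical
  rw [TT_succ]
  exact Finset.sum_eq_zero fun w _ => by simp

lemma TT_two_of (N a b : ℕ) : TT (N + 1) a b 0 2 = 0 := by
  classical
  rw [TT_succ]
  exact Finset.sum_eq_zero fun w _ => by simp

noncomputable def f1 (a : ℕ) : ℕ → ℕ → Polynomial ℤ
  | 0, _ => 0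
  | b + 1, c => qBinom (a + b + c) b * (qD a c - (1 - X ^ (a + c)) * qD' a c)

lemma f_sum (a b c : ℕ) :
    X ^ b * qBinom (a + b + c - 1) b * (qD a c - qD' a c) + f1 a b c
      + qBinom (a + b + c - 1) b * qD' a c = qBinom (a + b + c) b * qD a c := by
  cases b with
  | zero => simp [f1, qBinom_zero_right]
  | succ b =>
    have h := qBinom_A (a + b + c) b (a + c) (by omega)
    simp only [f1]
    rw [show a + (b + 1) + c = a + b + c + 1 by ring, Nat.add_sub_cancel, qBinom_succ_succ]
    linear_combination qD' a c * h

theorem TT_main : ∀ (N a b c : ℕ), N = a + b + c → c ≤ a →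
    TT N a b c 0 = X ^ b * qBinom (a + b + c - 1) b * (qD a c - qD' a c) ∧
    TT N a b c 1 = f1 a b c ∧
    TT N a b c 2 = qBinom (a + b + c - 1) b * qD' a c := by
  intro N
  induction N with
  | zero =>
    intro a b c h _
    obtain rfl : a = 0 := by omega
    obtain rfl : b = 0 := by omega
    obtain rfl : c = 0 := by omega
    simp [TT, cnt, Pref, pcnt, lastL, wMaj, qBinom, qD, qD', f1]
  | succ N ih =>
    intro a b c h hca
    refine ⟨?_, ?_, ?_⟩
    · cases a with
      | zero =>
        obtain rfl : c = 0 := by omega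
        rw [TT_zero_of, qBinom_eq_zero _ _ (by omega)]
        simp
      | succ a =>
        rw [TT_succ_zero _ _ _ _ hca]
        rcases Nat.lt_or_ge a c with hac | hac
        · obtain rfl : c = a + 1 := by omega
          rw [TT_bad _ _ _ _ _ hac, TT_bad _ _ _ _ _ hac, TT_bad _ _ _ _ _ hac]
          simp only [qD']
          rw [qD_diag]
          simp
        · obtain ⟨h0, h1, h2⟩ := ih a b c (by omega) hac
          have hs := f_sum a b c
          rw [← h0, ← h1, ← h2] at hs
          have hE := qE_rec a c hac
          rw [hE, show a + 1 + b + c - 1 = a + b + c by omega]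
          obtain rfl : N = a + b + c := by omega
          have key : (1 - X ^ (a + c)) * qBinom (a + b + c) b =
              (1 - X ^ (a + b + c)) * qBinom (a + b + c - 1) b := by
            rcases Nat.eq_zero_or_pos (a + b + c) with hz | hz
            · obtain rfl : a = 0 := by omega
              obtain rfl : c = 0 := by omega
              obtain rfl : b = 0 := by omega
              simp
            · obtain ⟨M, hM⟩ : ∃ M, a + b + c = M + 1 := ⟨a + b + c - 1, by omega⟩
              rw [hM]
              exact qBinom_absorb M b (a + c) (by omega)
          have hT : TT (a + b + c) a b c 1 + TT (a + b + c) a b c 2 =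
            qBinom (a + b + c) b * qD a c - TT (a + b + c) a b c 0 := by
            linear_combination hs
          rw [hT, h0]
          linear_combination -X ^ b * (qD a c - qD' a c) * key
    · cases b with
      | zero => rw [TT_one_of]; rfl
      | succ b =>
        rw [TT_succ_one _ _ _ _ hca]
        obtain ⟨h0, h1, h2⟩ := ih a b c (by omega) hca
        have hs := f_sum a b c
        rw [← h0, ← h1, ← h2] at hs
        obtain rfl : N = a + b + c := by omega
        have key : (1 - X ^ (a + c)) * qBinom (a + b + c) b =
            (1 - X ^ (a + b + c)) * qBinom (a + b + c - 1) b := by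
          rcases Nat.eq_zero_or_pos (a + b + c) with hz | hz
          · obtain rfl : a = 0 := by omega
            obtain rfl : c = 0 := by omega
            obtain rfl : b = 0 := by omega
            simp
          · obtain ⟨M, hM⟩ : ∃ M, a + b + c = M + 1 := ⟨a + b + c - 1, by omega⟩
            rw [hM]
            exact qBinom_absorb M b (a + c) (by omega)
        have hT : TT (a + b + c) a b c 0 + TT (a + b + c) a b c 1 =
            qBinom (a + b + c) b * qD a c - TT (a + b + c) a b c 2 := by
          linear_combination hs
        rw [hT, h2]
        simp only [f1]
        linear_combination qD' a c * key
    · cases c with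
      | zero => rw [TT_two_of]; simp [qD']
      | succ c =>
        rw [TT_succ_two _ _ _ _ hca, SS_eq]
        obtain ⟨h0, h1, h2⟩ := ih a b c (by omega) (by omega)
        rw [h0, h1, h2, f_sum]
        rfl

theorem SS_main (a b c : ℕ) (h : c ≤ a) :
    SS (a + b + c) a b c = qBinom (a + b + c) b * qD a c := by
  obtain ⟨h0, h1, h2⟩ := TT_main (a + b + c) a b c rfl h
  rw [SS_eq, h0, h1, h2, f_sum]

/-- (Bonin–Shapiro–Simion) [n−k+1]_q · Σ_w q^maj(w) = [2n−k choose k]_q [2n−2k choose n−k]_q,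
summing over Schröder words of length 2n−k with k 1's, n−k 0's and n−k 2's whose every
prefix has at least as many 0's as 2's. -/
theorem maj_schroder (n k : ℕ) (hn : 1 ≤ n) (hk : k ≤ n) :
    qInt (n - k + 1) * ∑ᶠ w ∈ SchroederWords n k, (X : Polynomial ℤ) ^ wMaj w
      = qBinom (2 * n - k) k * qBinom (2 * n - 2 * k) (n - k) := by
  classical
  have hS : ∑ᶠ w ∈ SchroederWords n k, (X : Polynomial ℤ) ^ wMaj w
      = SS (2 * n - k) (n - k) k (n - k) := by
    rw [finsum_eq_sum_of_fintype]
    unfold SS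
    apply Finset.sum_congr rfl
    intro w _
    rw [finsum_eq_if]
    congr 1
    simp only [SchroederWords, Set.mem_ofPred_eq, cnt, Pref, pcnt, eq_iff_iff]
    tauto
  have hN : 2 * n - k = (n - k) + k + (n - k) := by omega
  rw [hS, hN, SS_main _ _ _ le_rfl, show 2 * n - 2 * k = 2 * (n - k) by omega, ← qD_final]
  ring
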